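/- With the standing setup, for each 1 ≤ i ≤ m-1 the map φ_i sending w to w·(a_i a_{i+1}) is a bijection from the block [u,v]^{(i)} onto the block [u,v]^{(i+1)}. -/

import Mathlib

open Equiv Finset Polynomial

/-- The odd diagram of a permutation of `Fin n` (0-based positions and values):
boxes `(i, j)` with `w i > j`, `i < w⁻¹ j`, and `i`, `w⁻¹ j` of different parity. -/
def oddDiagram {n : ℕ} (w : Equiv.Perm (Fin n)) : Set (Fin n × Fin n) :=
  {p | p.2 < w p.1 ∧ p.1 < w⁻¹ p.2 ∧ ((p.1 : ℕ) % 2 ≠ ((w⁻¹ p.2 : Fin n) : ℕ) % 2)}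

/-- The Bruhat order on `S_n`: the reflexive-transitive closure of the relations
`x < x * (i j)` whenever `i < j` and `x i < x j`. -/
def bruhatLE {n : ℕ} : Equiv.Perm (Fin n) → Equiv.Perm (Fin n) → Prop :=
  Relation.ReflTransGen (fun x y => ∃ i j : Fin n, i < j ∧ x i < x j ∧ y = x * Equiv.swap i j)

/-- Strict Bruhat order. -/
def bruhatLT {n : ℕ} (x y : Equiv.Perm (Fin n)) : Prop := bruhatLE x y ∧ x ≠ y

/-- The Coxeter length of a permutation, i.e. its number of inversions. -/
def invLength {n : ℕ} (w : Equiv.Perm (Fin n)) : ℕ :=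
  (Finset.univ.filter (fun p : Fin n × Fin n => p.1 < p.2 ∧ w p.2 < w p.1)).card

/-- A box in the column of the value `w s` lies in the odd diagram exactly when it records an
inversion with positions of different parity. -/
theorem mem_oddDiagram_apply {n : ℕ} (w : Equiv.Perm (Fin n)) (r s : Fin n) :
    (r, w s) ∈ oddDiagram w ↔ w s < w r ∧ r < s ∧ (r : ℕ) % 2 ≠ (s : ℕ) % 2 := by
  simp [oddDiagram]

/-- Sufficient conditions for a transposition of two positions to preserve the odd diagram. -/
theorem oddDiagram_mul_swap {n : ℕ} (w : Equiv.Perm (Fin n)) (p q : Fin n) (hpq : p < q)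
    (hpar : (p : ℕ) % 2 = (q : ℕ) % 2) (hw : w p < w q)
    (hmid : ∀ s, p < s → s < q → (s : ℕ) % 2 ≠ (p : ℕ) % 2 → w s < w p)
    (hright : ∀ s, q < s → (s : ℕ) % 2 ≠ (p : ℕ) % 2 → w p < w s → ¬ w s < w q) :
    oddDiagram (w * Equiv.swap p q) = oddDiagram w := by
  ext ⟨r, c⟩
  obtain ⟨s, rfl⟩ := w.surjective c
  rw [mem_oddDiagram_apply]
  have hs : w s = (w * Equiv.swap p q) (Equiv.swap p q s) := by simp
  rw [hs, mem_oddDiagram_apply, ← hs, Equiv.Perm.mul_apply]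
  have hrm := hmid r
  have hsm := hmid s
  have hsr := hright s
  have hinj : ∀ x y, w x = w y → x = y := fun x y h => w.injective h
  have h1 := hinj r p
  have h2 := hinj r q
  have h3 := hinj s p
  have h4 := hinj s q
  clear hs hmid hright hinj
  by_cases hrp : r = p
  · subst hrp
    rw [Equiv.swap_apply_left]
    by_cases hsp : s = r
    · subst hsp
      rw [Equiv.swap_apply_left]
      omega
    by_cases hsq : s = q
    · subst hsq
      rw [Equiv.swap_apply_right]
      omega
    rw [Equiv.swap_apply_of_ne_of_ne hsp hsq]
    omega
  by_cases hrq : r = q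
  · subst hrq
    rw [Equiv.swap_apply_right]
    by_cases hsp : s = p
    · subst hsp
      rw [Equiv.swap_apply_left]
      omega
    by_cases hsq : s = r
    · subst hsq
      rw [Equiv.swap_apply_right]
      omega
    rw [Equiv.swap_apply_of_ne_of_ne hsp hsq]
    omega
  rw [Equiv.swap_apply_of_ne_of_ne hrp hrq]
  by_cases hsp : s = p
  · subst hsp
    rw [Equiv.swap_apply_left]
    omega
  by_cases hsq : s = q
  · subst hsq
    rw [Equiv.swap_apply_right]
    omega
  rw [Equiv.swap_apply_of_ne_of_ne hsp hsq]

/-- The Bruhat order refines to the lexicographic order on the words of the inverses. -/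
theorem bruhatLE.toLex_inv_le {n : ℕ} {x y : Equiv.Perm (Fin n)} (h : bruhatLE x y) :
    toLex (fun j => x⁻¹ j) ≤ toLex (fun j => y⁻¹ j) := by
  induction h with
  | refl => exact le_rfl
  | @tail y z _ hstep ih =>
    obtain ⟨i, j, hij, hlt, rfl⟩ := hstep
    refine ih.trans (le_of_lt ?_)
    refine ⟨y i, fun c hc => ?_, ?_⟩
    · have hci : y⁻¹ c ≠ i := by
        rw [Ne, Equiv.Perm.inv_eq_iff_eq]
        rintro rfl
        exact absurd hc (lt_irrefl _)
      have hcj : y⁻¹ c ≠ j := by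
        rw [Ne, Equiv.Perm.inv_eq_iff_eq]
        rintro rfl
        exact absurd (lt_trans hc hlt) (lt_irrefl _)
      change y⁻¹ c = (y * Equiv.swap i j)⁻¹ c
      rw [mul_inv_rev, Equiv.swap_inv, Equiv.Perm.mul_apply,
        Equiv.swap_apply_of_ne_of_ne hci hcj]
    · simpa [mul_inv_rev] using hij

/-- If the endpoints of a Bruhat interval agree on the positions of all values below `k`, so does
every element of the interval. -/
theorem inv_apply_eq_of_bruhatLE {n : ℕ} {u v w : Equiv.Perm (Fin n)} (huw : bruhatLE u w)
    (hwv : bruhatLE w v) (k : Fin n) (huv : ∀ i < k, u⁻¹ i = v⁻¹ i) :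
    ∀ i < k, w⁻¹ i = u⁻¹ i := by
  intro i
  induction i using WellFoundedLT.induction with
  | ind i ih =>
    intro hik
    have hlow : ∀ j < i, w⁻¹ j = u⁻¹ j := fun j hj => ih j hj (hj.trans hik)
    refine le_antisymm ?_ ?_
    · rw [huv i hik]
      by_contra! hlt
      refine absurd hwv.toLex_inv_le (not_le_of_gt ⟨i, fun j hj => ?_, hlt⟩)
      exact ((hlow j hj).trans (huv j (hj.trans hik))).symm
    · by_contra! hlt
      exact absurd huw.toLex_inv_le (not_le_of_gt ⟨i, hlow, hlt⟩)

/-- With the standing setup, `φᵢ : w ↦ w · (aᵢ aᵢ₊₁)` is a bijection from the block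
`[u,v]⁽ⁱ⁾` onto the block `[u,v]⁽ⁱ⁺¹⁾`. -/
theorem phi_bijection {n : ℕ} (D : Set (Fin n × Fin n)) (u v : Equiv.Perm (Fin n))
    (hu : oddDiagram u = D) (hv : oddDiagram v = D) (hne : u ≠ v)
    (hint : ∀ w : Equiv.Perm (Fin n), oddDiagram w = D ↔ (bruhatLE u w ∧ bruhatLE w v))
    (k : Fin n) (hk : u⁻¹ k ≠ v⁻¹ k) (hkmin : ∀ i : Fin n, i < k → u⁻¹ i = v⁻¹ i)
    (m : ℕ) (hm : 0 < m) (aseq : Fin m → Fin n) (hmono : StrictMono aseq)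
    (hrange : ∀ i : Fin n, (∃ j : Fin m, aseq j = i) ↔
      (u⁻¹ k ≤ i ∧ i ≤ v⁻¹ k ∧ u (u⁻¹ k) ≤ u i ∧ u i ≤ u (v⁻¹ k))) :
    ∀ (i : ℕ) (h : i + 1 < m),
      Set.BijOn
        (fun w => w * Equiv.swap (aseq ⟨i, Nat.lt_of_succ_lt h⟩) (aseq ⟨i + 1, h⟩))
        {w : Equiv.Perm (Fin n) |
          bruhatLE u w ∧ bruhatLE w v ∧ w⁻¹ k = aseq ⟨i, Nat.lt_of_succ_lt h⟩}
        {w : Equiv.Perm (Fin n) |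
          bruhatLE u w ∧ bruhatLE w v ∧ w⁻¹ k = aseq ⟨i + 1, h⟩} := by
  intro i h
  set p := aseq ⟨i, Nat.lt_of_succ_lt h⟩ with hp
  set q := aseq ⟨i + 1, h⟩ with hq
  set a := u⁻¹ k with ha
  set b := v⁻¹ k with hb
  have hua : u a = k := by simp [ha]
  have hvb : v b = k := by simp [hb]
  have hpq : p < q := hmono (by simp)
  obtain ⟨hap, -, hkp, hpb⟩ := (hrange p).mp ⟨_, rfl⟩
  obtain ⟨-, hqb, hkq, hqu⟩ := (hrange q).mp ⟨_, rfl⟩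
  rw [hua] at hkp hkq
  have hab : a < b := hap.trans_lt (hpq.trans_le hqb)
  have low : ∀ w, bruhatLE u w → bruhatLE w v → ∀ s, (u s < k ↔ w s < k) := by
    intro w h1 h2 s
    have key := inv_apply_eq_of_bruhatLE h1 h2 k hkmin
    constructor <;> intro hs
    · have := key _ hs
      rw [Equiv.Perm.inv_eq_iff_eq, Equiv.Perm.inv_eq_iff_eq.mpr rfl] at this
      exact this ▸ hs
    · have := key _ hs
      rw [eq_comm, Equiv.Perm.inv_eq_iff_eq, Equiv.Perm.inv_eq_iff_eq.mpr rfl] at this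
      exact this ▸ hs
  obtain ⟨huu, huv⟩ := (hint u).mp hu
  obtain ⟨-, hvv⟩ := (hint v).mp hv
  have hmemD : ∀ w, oddDiagram w = D → ∀ r s, (r, w s) ∈ D ↔
      w s < w r ∧ r < s ∧ (r : ℕ) % 2 ≠ (s : ℕ) % 2 := by
    rintro w rfl r s
    exact mem_oddDiagram_apply w r s
  have free : ∀ s, a ≤ s → s < b → (s : ℕ) % 2 ≠ (b : ℕ) % 2 → u s < k := by
    intro s has hsb hpar
    rw [low v huv hvv]
    have h1 := hmemD u hu s a
    have h2 := hmemD v hv s b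
    rw [hua] at h1
    rw [hvb] at h2
    have h3 : v s ≠ k := fun e => hsb.ne (v.injective (e.trans hvb.symm))
    by_contra h4
    exact absurd (h1.mp (h2.mpr ⟨by omega, hsb, hpar⟩)).2.1 (not_lt_of_ge has)
  have par : ∀ s, a ≤ s → s ≤ b → k ≤ u s → (s : ℕ) % 2 = (b : ℕ) % 2 := by
    intro s h1 h2 h3
    by_contra h4
    have hsb : s ≠ b := by rintro rfl; exact h4 rfl
    exact absurd (free s h1 (lt_of_le_of_ne h2 hsb) h4) (not_lt_of_ge h3)
  have hpp := par p hap (hpq.le.trans hqb) hkp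
  have hqp := par q (hap.trans hpq.le) hqb hkq
  have row_b : ∀ c, (b, c) ∈ D → c < k := by
    intro c hc
    obtain ⟨s, rfl⟩ := v.surjective c
    rw [hmemD v hv, hvb] at hc
    exact hc.1
  have row : ∀ s, a ≤ s → s ≤ b → k ≤ u s → u s ≤ u b → ∀ c, (s, c) ∈ D → c < k := by
    intro s h1 h2 h3 h4 c hc
    have h5 := par s h1 h2 h3
    obtain ⟨t, rfl⟩ := u.surjective c
    rw [hmemD u hu] at hc
    obtain ⟨h6, h7, h8⟩ := hc
    rcases lt_or_ge t b with htb | htb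
    · exact free t (h1.trans h7.le) htb (by omega)
    · refine row_b _ ((hmemD u hu b t).mpr ⟨h6.trans_le h4, ?_, by omega⟩)
      refine lt_of_le_of_ne htb ?_
      rintro rfl
      exact h8 h5
  have row_p := row p hap (hpq.le.trans hqb) hkp hpb
  have row_q := row q (hap.trans hpq.le) hqb hkq hqu
  have fwd : ∀ w, bruhatLE u w → bruhatLE w v → w p = k →
      oddDiagram (w * Equiv.swap p q) = D := by
    intro w h1 h2 hwp
    have hD := (hint w).mpr ⟨h1, h2⟩
    have hwq : k < w q := by
      refine lt_of_le_of_ne (not_lt.mp fun e => ?_) fun e => ?_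
      · exact absurd ((low w h1 h2 q).mpr e) (not_lt_of_ge hkq)
      · exact hpq.ne (w.injective (hwp.trans e))
    rw [← hD]
    refine oddDiagram_mul_swap w p q hpq (hpp.trans hqp.symm) (hwp ▸ hwq) ?_ ?_
    · intro s hps hsq hs
      rw [hwp, ← low w h1 h2]
      exact free s (hap.trans hps.le) (hsq.trans_le hqb) (hpp ▸ hs)
    · intro s hqs hs hks hlt
      rw [hwp] at hks
      have := row_q _ ((hmemD w hD q s).mpr ⟨hlt, hqs, by omega⟩)
      exact absurd (this.trans hks) (lt_irrefl _)
  have bwd : ∀ w, bruhatLE u w → bruhatLE w v → w q = k →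
      oddDiagram (w * Equiv.swap p q) = D := by
    intro w h1 h2 hwq
    have hD := (hint w).mpr ⟨h1, h2⟩
    have hwp : k < w p := by
      refine lt_of_le_of_ne (not_lt.mp fun e => ?_) fun e => ?_
      · exact absurd ((low w h1 h2 p).mpr e) (not_lt_of_ge hkp)
      · exact hpq.ne' (w.injective (hwq.trans e))
    have hself : w * Equiv.swap p q * Equiv.swap p q = w := by simp [mul_assoc]
    have happ : ∀ s, s ≠ p → s ≠ q → (w * Equiv.swap p q) s = w s := fun s h3 h4 => by
      rw [Equiv.Perm.mul_apply, Equiv.swap_apply_of_ne_of_ne h3 h4]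
    have hleft : (w * Equiv.swap p q) p = k := by simp [hwq]
    have hright : (w * Equiv.swap p q) q = w p := by simp
    rw [← hD]
    conv_rhs => rw [← hself]
    refine (oddDiagram_mul_swap _ p q hpq (hpp.trans hqp.symm) ?_ ?_ ?_).symm
    · rw [hleft, hright]
      exact hwp
    · intro s hps hsq hs
      rw [hleft, happ s hps.ne' hsq.ne, ← low w h1 h2]
      exact free s (hap.trans hps.le) (hsq.trans_le hqb) (hpp ▸ hs)
    · intro s hqs hs hks hlt
      rw [hleft, happ s (hpq.trans hqs).ne' hqs.ne'] at hks
      rw [hright, happ s (hpq.trans hqs).ne' hqs.ne'] at hlt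
      have := row_p _ ((hmemD w hD p s).mpr ⟨hlt, hpq.trans hqs, hs.symm⟩)
      exact absurd (this.trans hks) (lt_irrefl _)
  refine ⟨?_, fun w _ w' _ e => mul_right_cancel e, ?_⟩
  · rintro w ⟨h1, h2, h3⟩
    have hwp : w p = k := (Equiv.Perm.inv_eq_iff_eq.mp h3).symm
    obtain ⟨h4, h5⟩ := (hint _).mp (fwd w h1 h2 hwp)
    exact ⟨h4, h5, by rw [Equiv.Perm.inv_eq_iff_eq]; simp [hwp]⟩
  · rintro w ⟨h1, h2, h3⟩
    have hwq : w q = k := (Equiv.Perm.inv_eq_iff_eq.mp h3).symm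
    obtain ⟨h4, h5⟩ := (hint _).mp (bwd w h1 h2 hwq)
    exact ⟨w * Equiv.swap p q, ⟨h4, h5, by rw [Equiv.Perm.inv_eq_iff_eq]; simp [hwq]⟩, by simp [mul_assoc]⟩
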